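/- There are only finitely many positive integers n for which the reciprocal Farey product F̄_n = (∏_{1≤h≤k≤n, gcd(h,k)=1} h/k)^{-1} is an integer. -/

import Mathlib

open Finset

/-- The Farey product: product of all reduced fractions h/k with 1 ≤ h ≤ k ≤ n, gcd(h,k)=1. -/
def fareyProd (n : ℕ) : ℚ :=
  ∏ k ∈ Finset.Icc 1 n, ∏ h ∈ (Finset.Icc 1 k).filter (fun h => Nat.gcd h k = 1), (h : ℚ) / k

/-- The reciprocal Farey product F̄_n. -/
def recipFareyProd (n : ℕ) : ℚ := (fareyProd n)⁻¹

theorem card_Icc_filter_gcd_eq_totient (k : ℕ) :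
    #{h ∈ Icc 1 k | Nat.gcd h k = 1} = k.totient := by
  rw [← Nat.filter_coprime_Ico_eq_totient k 1]
  congr 1
  ext h
  simp only [mem_filter, mem_Icc, mem_Ico, Nat.coprime_iff_gcd_eq_one, Nat.gcd_comm k h]
  omega

theorem prod_num_dvd_prod_den {n : ℕ} {z : ℤ} (hz : recipFareyProd n = z) :
    (∏ k ∈ Icc 1 n, ∏ h ∈ Icc 1 k with Nat.gcd h k = 1, h) ∣ ∏ k ∈ Icc 1 n, k ^ k.totient := by
  have hnum : (∏ k ∈ Icc 1 n, ∏ h ∈ Icc 1 k with Nat.gcd h k = 1, (h : ℚ)) ≠ 0 := by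
    refine prod_ne_zero_iff.2 fun k _ => prod_ne_zero_iff.2 fun h hh => ?_
    simp only [mem_filter, mem_Icc] at hh
    exact_mod_cast (by omega : h ≠ 0)
  have hz' : (∏ k ∈ Icc 1 n, (k : ℚ) ^ k.totient) =
      (∏ k ∈ Icc 1 n, ∏ h ∈ Icc 1 k with Nat.gcd h k = 1, (h : ℚ)) * z := by
    rw [← hz, recipFareyProd, fareyProd]
    simp only [prod_div_distrib, prod_const, card_Icc_filter_gcd_eq_totient, inv_div]
    field_simp
  rw [← Int.natCast_dvd_natCast]
  refine ⟨z, (Int.cast_inj (α := ℚ)).1 ?_⟩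
  push_cast
  exact hz'

/-- For `p ≤ n < p ^ 2`, the number of pairs `(h, k)` in the Farey product with `p ∣ h` is at most
the number of those with `p ∣ k`. -/
theorem card_num_le_card_den {n p : ℕ} {z : ℤ} (hz : recipFareyProd n = z) (hp : p.Prime)
    (hn : n < p ^ 2) :
    ∑ k ∈ Icc 1 n, #{h ∈ Icc 1 k | Nat.gcd h k = 1 ∧ p ∣ h} ≤
      ∑ k ∈ Icc 1 n with p ∣ k, k.totient := by
  have hden : ∀ k ∈ Icc 1 n, k ^ k.totient ≠ 0 := fun k hk =>
    pow_ne_zero _ (by simp only [mem_Icc] at hk; omega)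
  have hnum : ∀ k ∈ Icc 1 n, ∀ h ∈ (Icc 1 k).filter (fun h => Nat.gcd h k = 1), h ≠ 0 := by
    intro k _ h hh
    simp only [mem_filter, mem_Icc] at hh
    omega
  have hle := (Nat.factorization_le_iff_dvd
    (prod_ne_zero_iff.2 fun k hk => prod_ne_zero_iff.2 (hnum k hk))
    (prod_ne_zero_iff.2 hden)).2 (prod_num_dvd_prod_den hz) p
  rw [Nat.factorization_prod_apply hden,
    Nat.factorization_prod_apply (fun k hk => prod_ne_zero_iff.2 (hnum k hk))] at hle
  refine le_trans (sum_le_sum fun k hk => ?_) (hle.trans ?_)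
  · rw [Nat.factorization_prod_apply (hnum k hk), ← filter_filter, card_filter]
    refine sum_le_sum fun h hh => ?_
    split_ifs with hd
    · exact (hp.dvd_iff_one_le_factorization (hnum k hk h hh)).1 hd
    · exact Nat.zero_le _
  · rw [sum_filter]
    refine sum_le_sum fun k hk => ?_
    simp only [mem_Icc] at hk
    rw [Nat.factorization_pow, Finsupp.smul_apply, smul_eq_mul]
    split_ifs with hd
    · have : k.factorization p < 2 := by
        by_contra! h2
        have := Nat.le_of_dvd (by omega) ((hp.pow_dvd_iff_le_factorization (by omega)).2 h2)
        omega
      nlinarith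
    · rw [Nat.factorization_eq_zero_of_not_dvd hd, mul_zero]

theorem sum_totient_multiples {n p : ℕ} (hp : p.Prime) (hn : n < p ^ 2) :
    ∑ k ∈ Icc 1 n with p ∣ k, k.totient = (p - 1) * ∑ j ∈ Icc 1 (n / p), j.totient := by
  have hp0 := hp.pos
  rw [mul_sum]
  symm
  refine sum_bij (fun j _ => p * j) ?_ ?_ ?_ ?_
  · intro j hj
    simp only [mem_Icc, mem_filter, Nat.le_div_iff_mul_le hp0] at hj ⊢
    exact ⟨⟨Nat.mul_pos hp0 hj.1, by linarith⟩, dvd_mul_right _ _⟩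
  · intro a _ b _ hab
    exact Nat.eq_of_mul_eq_mul_left hp0 hab
  · intro k hk
    simp only [mem_Icc, mem_filter] at hk
    obtain ⟨⟨h1, h2⟩, j, rfl⟩ := hk
    refine ⟨j, ?_, rfl⟩
    simp only [mem_Icc, Nat.le_div_iff_mul_le hp0]
    exact ⟨Nat.pos_of_mul_pos_left h1, by linarith⟩
  · intro j hj
    simp only [mem_Icc, Nat.le_div_iff_mul_le hp0] at hj
    have : ¬ p ∣ j := fun hd => by
      have := Nat.le_of_dvd (by omega) hd
      nlinarith
    rw [Nat.totient_mul ((Nat.Prime.coprime_iff_not_dvd hp).2 this), Nat.totient_prime hp]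

theorem sum_card_coprime_Icc (m : ℕ) :
    ∑ j ∈ Icc 1 m, #{i ∈ Icc j m | j.Coprime i} = ∑ i ∈ Icc 1 m, i.totient := by
  simp_rw [← card_Icc_filter_gcd_eq_totient, card_filter]
  rw [sum_comm' (t' := Icc 1 m) (s' := fun i => Icc 1 i)]
  intro j i
  simp only [mem_Icc]
  omega

/-- The count, over all `j ≤ n / p`, of the integers in `[p * j, n]` coprime to `j`. -/
theorem sum_card_coprime_le {n p : ℕ} {z : ℤ} (hz : recipFareyProd n = z) (hp : p.Prime)
    (hn : n < p ^ 2) :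
    ∑ j ∈ Icc 1 (n / p), #{k ∈ Icc (p * j) n | j.Coprime k} ≤
      p * ∑ j ∈ Icc 1 (n / p), j.totient := by
  have hp0 := hp.pos
  have hsplit : ∀ j ∈ Icc 1 (n / p), #{k ∈ Icc (p * j) n | j.Coprime k} ≤
      #{k ∈ Icc 1 n | p * j ≤ k ∧ (p * j).Coprime k} + #{i ∈ Icc j (n / p) | j.Coprime i} := by
    intro j hj
    simp only [mem_Icc] at hj
    rw [← card_image_of_injective {i ∈ Icc j (n / p) | j.Coprime i}
      (mul_right_injective₀ hp.ne_zero)]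
    refine (card_le_card fun k hk => ?_).trans (card_union_le _ _)
    simp only [mem_filter, mem_Icc, mem_union, mem_image] at hk ⊢
    by_cases hd : p ∣ k
    · obtain ⟨i, rfl⟩ := hd
      refine Or.inr ⟨i, ⟨⟨Nat.le_of_mul_le_mul_left hk.1.1 hp0, ?_⟩, hk.2.coprime_mul_left_right⟩,
        rfl⟩
      rw [Nat.le_div_iff_mul_le hp0]
      linarith [hk.1.2]
    · exact Or.inl ⟨⟨(Nat.mul_pos hp0 hj.1).trans_le hk.1.1, hk.1.2⟩, hk.1.1,
        Nat.Coprime.mul_left ((Nat.Prime.coprime_iff_not_dvd hp).2 hd) hk.2⟩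
  have hpairs : ∑ j ∈ Icc 1 (n / p), #{k ∈ Icc 1 n | p * j ≤ k ∧ (p * j).Coprime k} ≤
      ∑ k ∈ Icc 1 n, #{h ∈ Icc 1 k | Nat.gcd h k = 1 ∧ p ∣ h} := by
    simp_rw [card_filter _ (Icc 1 n)]
    rw [sum_comm]
    refine sum_le_sum fun k _ => ?_
    rw [← card_filter, ← card_image_of_injective _ (mul_right_injective₀ hp.ne_zero)]
    refine card_le_card fun h hh => ?_
    simp only [mem_filter, mem_Icc, mem_image] at hh ⊢
    obtain ⟨j, ⟨hj, hjk, hc⟩, rfl⟩ := hh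
    exact ⟨⟨Nat.mul_pos hp0 hj.1, hjk⟩, hc, dvd_mul_right _ _⟩
  have h1 := sum_le_sum hsplit
  rw [sum_add_distrib, sum_card_coprime_Icc] at h1
  have h2 := hpairs.trans (card_num_le_card_den hz hp hn)
  rw [sum_totient_multiples hp hn] at h2
  obtain ⟨q, rfl⟩ : ∃ q, p = q + 1 := ⟨p - 1, by omega⟩
  rw [Nat.add_sub_cancel] at h2
  linarith

theorem totient_mul_le_card_coprime_Icc {a n j : ℕ} (hj : 0 < j) :
    j.totient * ((n + 1 - a) / j) ≤ #{k ∈ Icc a n | j.Coprime k} := by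
  obtain ⟨q, hq⟩ : ∃ q, (n + 1 - a) / j = q := ⟨_, rfl⟩
  have hle : j * q ≤ n + 1 - a := hq ▸ Nat.mul_div_le _ _
  rw [hq]
  have key : ∀ q b : ℕ, #{k ∈ Ico b (b + j * q) | j.Coprime k} = j.totient * q := by
    intro q
    induction q with
    | zero => simp
    | succ q ih =>
      intro b
      rw [← Ico_union_Ico_eq_Ico (b := b + j * q) (by omega) (by nlinarith), filter_union,
        card_union_of_disjoint (disjoint_filter_filter (Ico_disjoint_Ico_consecutive _ _ _)), ih,
        mul_add, ← add_assoc, mul_one, Nat.filter_coprime_Ico_eq_totient]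
      ring
  rw [← key q a]
  refine card_le_card (filter_subset_filter _ fun k hk => ?_)
  simp only [mem_Icc, mem_Ico] at hk ⊢
  omega

theorem sum_totient_mul_div_le {n p : ℕ} {z : ℤ} (hz : recipFareyProd n = z) (hp : p.Prime)
    (hn : n < p ^ 2) :
    ∑ j ∈ Icc 1 (n / p), j.totient * ((n + 1) / j) ≤ 2 * p * ∑ j ∈ Icc 1 (n / p), j.totient := by
  have h := sum_card_coprime_le hz hp hn
  have : ∀ j ∈ Icc 1 (n / p), j.totient * ((n + 1) / j) ≤
      #{k ∈ Icc (p * j) n | j.Coprime k} + j.totient * p := by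
    intro j hj
    simp only [mem_Icc] at hj
    refine le_trans ?_ (Nat.add_le_add_right (totient_mul_le_card_coprime_Icc hj.1) _)
    rw [← mul_add, mul_comm p j, Nat.sub_mul_div]
    gcongr
    omega
  have := sum_le_sum this
  rw [sum_add_distrib, ← sum_mul] at this
  linarith

/-- The constraint that integrality imposes on the primes `p` with `⌊3 n / p⌋ = y`; it bounds `p`
as soon as the coefficient of `p` is positive. -/
theorem prime_mul_le_of_recipFareyProd_eq_intCast {n p y : ℕ} {z : ℤ}
    (hz : recipFareyProd n = z) (hp : p.Prime) (hn : n < p ^ 2) (hy : 3 * n / p = y) :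
    (p : ℚ) * (y * (∑ j ∈ Icc 1 (y / 3), (j.totient : ℚ) / j) -
      6 * ∑ j ∈ Icc 1 (y / 3), (j.totient : ℚ)) ≤
      3 * (∑ j ∈ Icc 1 (y / 3), (j.totient : ℚ)) -
        6 * (∑ j ∈ Icc 1 (y / 3), (j.totient : ℚ) / j) := by
  have hm : y / 3 = n / p := by
    rw [← hy, Nat.div_div_eq_div_mul, mul_comm p 3, ← Nat.div_div_eq_div_mul,
      Nat.mul_div_cancel_left _ (by norm_num)]
  have h := sum_totient_mul_div_le hz hp hn
  rw [← hm] at h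
  have hyp : (y : ℚ) * p ≤ 3 * n := by
    exact_mod_cast hy ▸ Nat.div_mul_le_self (3 * n) p
  have hfloor : ∀ j ∈ Icc 1 (y / 3), ((n : ℚ) + 2) * (j.totient / j) - j.totient ≤
      (j.totient * ((n + 1) / j) : ℕ) := by
    intro j hj
    simp only [mem_Icc] at hj
    have hj0 : (0 : ℚ) < j := by exact_mod_cast hj.1
    have : ((n : ℚ) + 2) ≤ j * (((n + 1) / j : ℕ) : ℚ) + j := by
      have h1 := Nat.div_add_mod (n + 1) j
      have h2 := Nat.mod_lt (n + 1) hj.1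
      exact_mod_cast (by omega : n + 2 ≤ j * ((n + 1) / j) + j)
    rw [Nat.cast_mul]
    have h3 : ((n : ℚ) + 2) / j ≤ (((n + 1) / j : ℕ) : ℚ) + 1 := by
      rw [div_le_iff₀ hj0]
      linarith
    calc ((n : ℚ) + 2) * (j.totient / j) - j.totient
        = j.totient * (((n : ℚ) + 2) / j - 1) := by ring
      _ ≤ _ := by
        gcongr
        linarith
  have hs := sum_le_sum hfloor
  rw [sum_sub_distrib, ← mul_sum, ← Nat.cast_sum] at hs
  have h' := (Nat.cast_le (α := ℚ)).2 h
  push_cast at h' hs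
  have hS : (0 : ℚ) ≤ ∑ j ∈ Icc 1 (y / 3), (j.totient : ℚ) / j :=
    sum_nonneg fun _ _ => by positivity
  nlinarith [mul_le_mul_of_nonneg_right hyp hS]

open scoped Nat ArithmeticFunction.vonMangoldt

theorem log_factorial_bounds (m : ℕ) :
    ((m + 1 : ℕ) : ℝ) * Real.log (m + 1 : ℕ) - (m + 1 : ℕ) + 1 ≤ Real.log ((m + 1)! : ℕ) ∧
      Real.log ((m + 1)! : ℕ) ≤
        ((m + 1 : ℕ) : ℝ) * Real.log (m + 1 : ℕ) - (m + 1 : ℕ) + 1 + Real.log (m + 1 : ℕ) := by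
  induction m with
  | zero => simp
  | succ m ih =>
    have hx : (0 : ℝ) < (m + 1 : ℕ) := by positivity
    obtain ⟨x, hxdef⟩ : ∃ x : ℝ, ((m + 1 : ℕ) : ℝ) = x := ⟨_, rfl⟩
    rw [Nat.factorial_succ (m + 1), Nat.cast_mul, Real.log_mul (by positivity) (by positivity),
      Nat.cast_add (m + 1) 1, Nat.cast_one]
    rw [hxdef] at ih hx ⊢
    have h1 := Real.log_le_sub_one_of_pos (show 0 < (x + 1) / x by positivity)
    have h2 := Real.log_le_sub_one_of_pos (show 0 < x / (x + 1) by positivity)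
    rw [Real.log_div (by positivity) (by positivity)] at h1 h2
    have h3 : x * (Real.log (x + 1) - Real.log x) ≤ 1 := by
      refine (mul_le_mul_of_nonneg_left h1 hx.le).trans_eq ?_
      field_simp
      ring
    have h4 : (x + 1) * (Real.log x - Real.log (x + 1)) ≤ -1 := by
      refine (mul_le_mul_of_nonneg_left h2 (by positivity)).trans_eq ?_
      field_simp
      ring
    constructor <;> nlinarith

theorem abs_log_factorial_floor_sub_le {x : ℝ} (hx : 1 ≤ x) :
    |Real.log (⌊x⌋₊ ! : ℕ) - (x * Real.log x - x)| ≤ 1 + Real.log x := by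
  obtain ⟨m, hm⟩ : ∃ m, ⌊x⌋₊ = m + 1 :=
    ⟨⌊x⌋₊ - 1, by have := (Nat.one_le_floor_iff x).2 hx; omega⟩
  obtain ⟨h1, h2⟩ := log_factorial_bounds m
  rw [← hm] at h1 h2
  have hle : (⌊x⌋₊ : ℝ) ≤ x := Nat.floor_le (by linarith)
  have hlt : x < ⌊x⌋₊ + 1 := Nat.lt_floor_add_one x
  have hone : (1 : ℝ) ≤ ⌊x⌋₊ := by exact_mod_cast (Nat.one_le_floor_iff x).2 hx
  generalize (⌊x⌋₊ : ℝ) = M at *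
  have hlogM : 0 ≤ Real.log M := Real.log_nonneg hone
  have hlogx : 0 ≤ Real.log x := Real.log_nonneg hx
  have hlogle : Real.log M ≤ Real.log x := Real.log_le_log (by linarith) hle
  have h3 := Real.log_le_sub_one_of_pos (show 0 < x / M by positivity)
  have h4 := Real.log_le_sub_one_of_pos (show 0 < M / x by positivity)
  rw [Real.log_div (by positivity) (by positivity)] at h3 h4
  have h5 : M * (Real.log x - Real.log M) ≤ x - M := by
    refine (mul_le_mul_of_nonneg_left h3 (by linarith)).trans_eq ?_
    field_simp
  have h6 : x * (Real.log M - Real.log x) ≤ M - x := by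
    refine (mul_le_mul_of_nonneg_left h4 (by linarith)).trans_eq ?_
    field_simp
  rw [abs_le]
  constructor <;> nlinarith

theorem sum_vonMangoldt_mul_div (N : ℕ) :
    ∑ k ∈ Ioc 0 N, Λ k * ((N / k : ℕ) : ℝ) = Real.log (N ! : ℕ) := by
  rw [← ArithmeticFunction.sum_Ioc_mul_zeta_eq_sum, ArithmeticFunction.vonMangoldt_mul_zeta]
  simp only [ArithmeticFunction.log_apply]
  rw [← Finset.prod_Ico_id_eq_factorial, Nat.cast_prod, Real.log_prod]
  · exact sum_congr (by ext; simp; omega) fun _ _ => rfl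
  · intro k hk
    simp only [mem_Ico] at hk
    exact_mod_cast (by omega : k ≠ 0)

theorem sum_vonMangoldt_mul_div_div (N d : ℕ) :
    ∑ k ∈ Ioc 0 N, Λ k * ((N / k / d : ℕ) : ℝ) = Real.log ((N / d)! : ℕ) := by
  rw [← sum_vonMangoldt_mul_div]
  symm
  have hsub : Ioc 0 (N / d) ⊆ Ioc 0 N := Ioc_subset_Ioc_right (Nat.div_le_self N d)
  rw [sum_subset hsub]
  · exact sum_congr rfl fun k _ => by
      rw [Nat.div_div_eq_div_mul, Nat.div_div_eq_div_mul, Nat.mul_comm d k]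
  · intro k hk hk'
    simp only [mem_Ioc] at hk hk'
    rw [Nat.div_eq_of_lt (by omega : N / d < k)]
    simp

/-- The step function `y ↦ ∑ a * ⌊y / d⌋` attached to a finite set of pairs `(d, a)`. -/
def stepSum (s : Finset (ℕ × ℤ)) (y : ℕ) : ℤ := ∑ w ∈ s, w.2 * (y / w.1 : ℕ)

/-- The monotone step function `y ↦ ∑_{t ≤ y} c` attached to a finite set of pairs `(t, c)`. -/
def monoStep (g : Finset (ℕ × ℕ)) (y : ℕ) : ℕ := ∑ w ∈ g with w.1 ≤ y, w.2

theorem sum_vonMangoldt_mul_stepSum (s : Finset (ℕ × ℤ)) (N : ℕ) :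
    ∑ k ∈ Ioc 0 N, Λ k * (stepSum s (N / k) : ℝ) =
      ∑ w ∈ s, (w.2 : ℝ) * Real.log ((N / w.1)! : ℕ) := by
  simp only [stepSum, Int.cast_sum, Int.cast_mul, Int.cast_natCast, mul_sum]
  rw [sum_comm]
  refine sum_congr rfl fun w _ => ?_
  rw [← sum_vonMangoldt_mul_div_div, mul_sum]
  exact sum_congr rfl fun k _ => by ring

theorem stepSum_le {s : Finset (ℕ × ℤ)} (hd : ∀ w ∈ s, 0 < w.1)
    (hs : ∑ w ∈ s, (w.2 : ℚ) / w.1 = 0) (y : ℕ) :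
    stepSum s y ≤ ∑ w ∈ s, max (-w.2) 0 := by
  have h : (stepSum s y : ℚ) = ∑ w ∈ s, (w.2 : ℚ) * ((y / w.1 : ℕ) - (y : ℚ) / w.1) := by
    have : ∑ w ∈ s, (w.2 : ℚ) * ((y : ℚ) / w.1) = 0 := by
      rw [← mul_zero (y : ℚ), ← hs, mul_sum]
      exact sum_congr rfl fun w _ => by ring
    simp only [mul_sub, sum_sub_distrib, this, stepSum, Int.cast_sum, Int.cast_mul,
      Int.cast_natCast, sub_zero]
  rw [← Int.cast_le (R := ℚ), h, Int.cast_sum]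
  refine sum_le_sum fun w hw => ?_
  have hw0 : (0 : ℚ) < w.1 := by exact_mod_cast hd w hw
  have h1 : ((y / w.1 : ℕ) : ℚ) ≤ (y : ℚ) / w.1 := Nat.cast_div_le
  have h2 : (y : ℚ) / w.1 ≤ (y / w.1 : ℕ) + 1 := by
    rw [div_le_iff₀ hw0]
    have := Nat.lt_div_mul_add (a := y) (hd w hw)
    have h3 : y ≤ (y / w.1 + 1) * w.1 := by linarith
    exact_mod_cast h3
  push_cast
  rcases le_total 0 w.2 with h0 | h0
  · have h0' : (0 : ℚ) ≤ w.2 := by exact_mod_cast h0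
    exact (mul_nonpos_of_nonneg_of_nonpos h0' (by linarith)).trans (le_max_right _ _)
  · have h0' : (w.2 : ℚ) ≤ 0 := by exact_mod_cast h0
    refine le_trans ?_ (le_max_left _ _)
    nlinarith

theorem sum_log_mul_monoStep (g : Finset (ℕ × ℕ)) (hg : ∀ w ∈ g, 0 < w.1) (N : ℕ) :
    ∑ p ∈ Ioc 0 N with p.Prime, Real.log p * (monoStep g (N / p) : ℝ) =
      ∑ w ∈ g, (w.2 : ℝ) * Chebyshev.theta ((N : ℝ) / w.1) := by
  have h (y : ℕ) : (monoStep g y : ℝ) = ∑ w ∈ g, if w.1 ≤ y then (w.2 : ℝ) else 0 := by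
    rw [monoStep, sum_filter]
    push_cast
    rfl
  simp only [h, mul_sum]
  rw [sum_comm]
  refine sum_congr rfl fun w hw => ?_
  have hsub : {p ∈ Ioc 0 (N / w.1) | p.Prime} ⊆ {p ∈ Ioc 0 N | p.Prime} :=
    filter_subset_filter _ (Ioc_subset_Ioc_right (Nat.div_le_self _ _))
  have hiff {p : ℕ} (hp : 0 < p) : w.1 ≤ N / p ↔ p ≤ N / w.1 := by
    rw [Nat.le_div_iff_mul_le hp, Nat.le_div_iff_mul_le (hg w hw), mul_comm]
  rw [Chebyshev.theta, Nat.floor_div_natCast, Nat.floor_natCast, mul_sum]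
  symm
  rw [← sum_subset hsub (f := fun p : ℕ => Real.log p * if w.1 ≤ N / p then (w.2 : ℝ) else 0)]
  · refine sum_congr rfl fun p hp => ?_
    simp only [mem_filter, mem_Ioc] at hp
    rw [if_pos ((hiff hp.1.1).2 hp.1.2), mul_comm]
  · intro p hp hp'
    simp only [mem_filter, mem_Ioc] at hp hp'
    rw [if_neg fun h => hp' ⟨⟨hp.1.1, (hiff hp.1.1).1 h⟩, hp.2⟩, mul_zero]

theorem sum_vonMangoldt_mul_stepSum_le {s : Finset (ℕ × ℤ)} {g : Finset (ℕ × ℕ)} {C : ℤ} {N : ℕ}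
    (hC : ∀ y, stepSum s y ≤ C)
    (hN : ∀ p ≤ N, p.Prime → stepSum s (N / p) ≤ monoStep g (N / p)) (hg : ∀ w ∈ g, 0 < w.1) :
    ∑ k ∈ Ioc 0 N, Λ k * (stepSum s (N / k) : ℝ) ≤
      ∑ w ∈ g, (w.2 : ℝ) * Chebyshev.theta ((N : ℝ) / w.1) +
        C * (Chebyshev.psi N - Chebyshev.theta N) := by
  have h : Chebyshev.psi N - Chebyshev.theta N = ∑ k ∈ Ioc 0 N with ¬ k.Prime, Λ k := by
    rw [Chebyshev.psi, Chebyshev.theta, Nat.floor_natCast, sub_eq_iff_eq_add',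
      ← sum_filter_add_sum_filter_not (Ioc 0 N) Nat.Prime]
    congr 1
    exact sum_congr rfl fun p hp =>
      ArithmeticFunction.vonMangoldt_apply_prime (mem_filter.1 hp).2
  rw [h, ← sum_log_mul_monoStep g hg, mul_sum,
    ← sum_filter_add_sum_filter_not (Ioc 0 N) Nat.Prime]
  refine add_le_add (sum_le_sum fun p hp => ?_) (sum_le_sum fun k _ => ?_)
  · simp only [mem_filter, mem_Ioc] at hp
    rw [ArithmeticFunction.vonMangoldt_apply_prime hp.2]
    refine mul_le_mul_of_nonneg_left ?_ (Real.log_natCast_nonneg p)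
    exact_mod_cast hN p hp.1.2 hp.2
  · rw [mul_comm]
    exact mul_le_mul_of_nonneg_right (by exact_mod_cast hC _)
      ArithmeticFunction.vonMangoldt_nonneg

theorem le_sum_mul_log_factorial {s : Finset (ℕ × ℤ)} (hd : ∀ w ∈ s, 0 < w.1)
    (hs : ∑ w ∈ s, (w.2 : ℚ) / w.1 = 0) {N : ℕ} (hN : ∀ w ∈ s, w.1 ≤ N) :
    -(∑ w ∈ s, (w.2 : ℝ) * Real.log w.1 / w.1) * N - (∑ w ∈ s, |(w.2 : ℝ)|) * (1 + Real.log N) ≤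
      ∑ w ∈ s, (w.2 : ℝ) * Real.log ((N / w.1)! : ℕ) := by
  have hs' : ∑ w ∈ s, (w.2 : ℝ) / w.1 = 0 := by exact_mod_cast congrArg (Rat.cast (K := ℝ)) hs
  have h : ∀ w ∈ s, (w.2 : ℝ) / w.1 * (N * Real.log N - N) - w.2 * Real.log w.1 / w.1 * N -
      |(w.2 : ℝ)| * (1 + Real.log N) ≤ (w.2 : ℝ) * Real.log ((N / w.1)! : ℕ) := by
    intro w hw
    have hw0 : (0 : ℝ) < w.1 := by exact_mod_cast hd w hw
    have hwN : (w.1 : ℝ) ≤ N := by exact_mod_cast hN w hw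
    have hb := abs_log_factorial_floor_sub_le ((one_le_div hw0).2 hwN)
    rw [Nat.floor_div_natCast, Nat.floor_natCast,
      Real.log_div (by linarith) hw0.ne'] at hb
    have hw1 : 0 ≤ Real.log w.1 := Real.log_natCast_nonneg _
    have hm := mul_le_mul_of_nonneg_left (hb.trans (by linarith : _ ≤ 1 + Real.log N))
      (abs_nonneg (w.2 : ℝ))
    rw [← abs_mul] at hm
    have := (abs_le.1 hm).1
    have he : (w.2 : ℝ) * (N / w.1 * (Real.log N - Real.log w.1) - N / w.1) =
        (w.2 : ℝ) / w.1 * (N * Real.log N - N) - w.2 * Real.log w.1 / w.1 * N := by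
      field_simp
      ring
    rw [mul_sub, he] at this
    linarith
  have := sum_le_sum h
  rw [sum_sub_distrib, sum_sub_distrib, ← sum_mul, ← sum_mul, ← sum_mul, hs'] at this
  linarith

theorem eventually_exists_prime_div_mem {s : Finset (ℕ × ℤ)} {g : Finset (ℕ × ℕ)} {B : Set ℕ}
    (hd : ∀ w ∈ s, 0 < w.1) (hs : ∑ w ∈ s, (w.2 : ℚ) / w.1 = 0) (hg : ∀ w ∈ g, 0 < w.1)
    (hB : ∀ y ∉ B, stepSum s y ≤ monoStep g y)
    (hlog : Real.log 4 * ∑ w ∈ g, (w.2 : ℝ) / w.1 < -∑ w ∈ s, (w.2 : ℝ) * Real.log w.1 / w.1) :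
    ∀ᶠ N : ℕ in Filter.atTop, ∃ p ≤ N, p.Prime ∧ N / p ∈ B := by
  obtain ⟨ε, hε, hlog⟩ : ∃ ε > 0, Real.log 4 * ∑ w ∈ g, (w.2 : ℝ) / w.1 + ε ≤
      -∑ w ∈ s, (w.2 : ℝ) * Real.log w.1 / w.1 := ⟨_, sub_pos.2 hlog, by linarith⟩
  obtain ⟨C, hC0, hC⟩ : ∃ C : ℤ, 0 ≤ C ∧ ∀ y, stepSum s y ≤ C :=
    ⟨_, sum_nonneg fun _ _ => le_max_right _ _, stepSum_le hd hs⟩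
  set A : ℝ := ∑ w ∈ s, |(w.2 : ℝ)|
  have ho : (fun x : ℝ => C * (2 * √x * Real.log x) + A * (1 + Real.log x)) =o[Filter.atTop]
      fun x : ℝ => x := by
    have h1 : (fun x : ℝ => √x * Real.log x) =o[Filter.atTop] fun x : ℝ => x := by
      have h := (Asymptotics.isBigO_refl (fun x : ℝ => √x) Filter.atTop).mul_isLittleO
        (isLittleO_log_rpow_atTop (show (0 : ℝ) < 1 / 2 by norm_num))
      refine h.congr' Filter.EventuallyEq.rfl ?_
      filter_upwards [Filter.eventually_ge_atTop 0] with x hx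
      rw [← Real.sqrt_eq_rpow, Real.mul_self_sqrt hx]
    have h2 := (Asymptotics.isLittleO_const_id_atTop (1 : ℝ)).add Real.isLittleO_log_id_atTop
    refine ((h1.const_mul_left (C * 2)).add (h2.const_mul_left A)).congr_left fun x => ?_
    ring
  have ho' := tendsto_natCast_atTop_atTop.eventually (ho.bound (half_pos hε))
  filter_upwards [ho', Filter.eventually_ge_atTop (s.sup Prod.fst), Filter.eventually_ge_atTop 1]
    with N hN hsup hN1
  by_contra! hp
  have hN1' : (1 : ℝ) ≤ N := by exact_mod_cast hN1
  have h1 := le_sum_mul_log_factorial hd hs fun w hw => (le_sup (f := Prod.fst) hw).trans hsup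
  have h2 := sum_vonMangoldt_mul_stepSum_le hC (fun p hpN hpp => hB _ (hp p hpN hpp)) hg
  rw [sum_vonMangoldt_mul_stepSum] at h2
  have h3 : ∑ w ∈ g, (w.2 : ℝ) * Chebyshev.theta ((N : ℝ) / w.1) ≤
      (Real.log 4 * ∑ w ∈ g, (w.2 : ℝ) / w.1) * N := by
    rw [mul_sum, sum_mul]
    refine sum_le_sum fun w _ => ?_
    refine (mul_le_mul_of_nonneg_left (Chebyshev.theta_le_log4_mul_x (by positivity))
      (by positivity)).trans_eq ?_
    ring
  have h4 : (C : ℝ) * (Chebyshev.psi N - Chebyshev.theta N) ≤ C * (2 * √N * Real.log N) :=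
    mul_le_mul_of_nonneg_left
      ((le_abs_self _).trans (Chebyshev.abs_psi_sub_theta_le_sqrt_mul_log hN1'))
      (by exact_mod_cast hC0)
  have h5 := (le_abs_self _).trans hN
  simp only [Real.norm_eq_abs, Nat.abs_cast] at h5
  have h6 := mul_le_mul_of_nonneg_right hlog (show (0 : ℝ) ≤ N by positivity)
  have h7 : 0 < ε * N := by positivity
  linarith

/-- The sum `∑ a * ⌊y / d⌋` over a list of pairs `(d, a)`. -/
def floorSum : List (ℕ × ℕ) → ℕ → ℕ
  | [], _ => 0
  | w :: l, y => w.2 * (y / w.1) + floorSum l y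

/-- The positive part of `chebyshevWeights`. -/
def positiveWeights : List (ℕ × ℕ) :=
  [(8, 8), (14, 6), (18, 8), (20, 3), (26, 8), (30, 6), (44, 8), (45, 6), (48, 8), (63, 11),
    (65, 3), (77, 2), (80, 11), (105, 9), (112, 7), (120, 4), (140, 1), (156, 1), (168, 7),
    (195, 2), (198, 5), (208, 7), (280, 1), (312, 1), (360, 7), (385, 1), (429, 2), (495, 1),
    (504, 2), (546, 2), (585, 2)]

/-- The negative part of `chebyshevWeights`, with its sign changed. -/
def negativeWeights : List (ℕ × ℕ) :=
  [(9, 8), (15, 6), (16, 8), (21, 3), (24, 8), (28, 6), (40, 11), (42, 3), (52, 8), (56, 8),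
    (60, 3), (66, 5), (70, 4), (78, 4), (88, 5), (90, 6), (99, 1), (104, 11), (126, 3),
    (132, 3), (144, 5), (220, 5), (234, 5), (240, 4), (252, 2), (308, 1)]

/-- Weights of a Chebyshev-type step function that is positive mostly on `exceptionalQuotients`. -/
def chebyshevWeights : Finset (ℕ × ℤ) where
  val := ↑(positiveWeights.map (fun w => (w.1, (w.2 : ℤ))) ++
    negativeWeights.map (fun w => (w.1, -(w.2 : ℤ))))
  nodup := by decide +kernel

theorem floorSum_eq_sum_map (l : List (ℕ × ℕ)) (y : ℕ) :
    floorSum l y = (l.map fun w => w.2 * (y / w.1)).sum := by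
  induction l with
  | nil => rfl
  | cons w l ih => simp [floorSum, ih]

theorem stepSum_chebyshevWeights (y : ℕ) :
    stepSum chebyshevWeights y = floorSum positiveWeights y - floorSum negativeWeights y := by
  have hneg (l : List (ℕ × ℕ)) : (l.map fun w => -(w.2 : ℤ) * (y / w.1 : ℕ)).sum =
      -((l.map fun w => w.2 * (y / w.1)).sum : ℕ) := by
    induction l with
    | nil => rfl
    | cons w l ih =>
      rw [List.map_cons, List.map_cons, List.sum_cons, List.sum_cons, ih]
      push_cast
      ring
  simp only [stepSum, Finset.sum, chebyshevWeights, Multiset.map_coe, Multiset.sum_coe,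
    List.map_append, List.map_map, List.sum_append, floorSum_eq_sum_map, Function.comp_def, hneg]
  push_cast
  simp [Function.comp_def, sub_eq_add_neg]

/-- Jumps of a monotone majorant of `stepSum chebyshevWeights` off `exceptionalQuotients`. -/
def majorantJumps : Finset (ℕ × ℕ) where
  val := ↑([(184, 4), (584, 3), (836, 2), (1386, 3), (1592, 1), (3608, 3), (6000, 120)] :
    List (ℕ × ℕ))
  nodup := by decide +kernel

/-- Values of `⌊3 * n / p⌋` that no large prime `p` can have if `recipFareyProd n` is an integer. -/
def exceptionalQuotients : Finset ℕ where
  val := ↑([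
    8, 14, 19, 20, 26, 29, 31, 32, 37, 38, 44, 47, 49, 50, 56, 62, 65, 67, 68, 74, 77, 80, 83,
    85, 86, 91, 92, 98] :
    List ℕ)
  nodup := by decide +kernel

set_option maxHeartbeats 4000000 in
theorem stepSum_chebyshevWeights_le {y : ℕ} (hy : y ∉ exceptionalQuotients) :
    stepSum chebyshevWeights y ≤ monoStep majorantJumps y := by
  rcases lt_or_ge y 6000 with hlt | hge
  · have h : ∀ i < 60, ∀ j < 100, 100 * i + j ∉ exceptionalQuotients →
        floorSum positiveWeights (100 * i + j) ≤
          monoStep majorantJumps (100 * i + j) + floorSum negativeWeights (100 * i + j) := by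
      decide +kernel
    have := h (y / 100) (by omega) (y % 100) (by omega)
    rw [Nat.div_add_mod] at this
    have := this hy
    rw [stepSum_chebyshevWeights]
    omega
  · have h : monoStep majorantJumps y = monoStep majorantJumps 6000 := by
      have hle : ∀ w ∈ majorantJumps, w.1 ≤ 6000 := by decide +kernel
      rw [monoStep, monoStep, filter_true_of_mem hle,
        filter_true_of_mem fun w hw => (hle w hw).trans hge]
    rw [h]
    exact (stepSum_le (by decide +kernel) (by decide +kernel) y).trans (by decide +kernel)

/-- The multiplicity of `p` in `d`, as long as it is at most `10`. -/
def smallMultiplicity (p d : ℕ) : ℕ := #{k ∈ range 10 | p ^ (k + 1) ∣ d}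

theorem log_four_mul_lt_chebyshevWeights :
    Real.log 4 * ∑ w ∈ majorantJumps, (w.2 : ℝ) / w.1 <
      -∑ w ∈ chebyshevWeights, (w.2 : ℝ) * Real.log w.1 / w.1 := by
  have hfac : ∀ w ∈ chebyshevWeights,
      ∏ p ∈ {2, 3, 5, 7, 11, 13}, p ^ smallMultiplicity p w.1 = w.1 := by decide +kernel
  have hlog : ∑ w ∈ chebyshevWeights, (w.2 : ℝ) * Real.log w.1 / w.1 =
      ∑ p ∈ {2, 3, 5, 7, 11, 13}, ((∑ w ∈ chebyshevWeights,
        (w.2 : ℚ) * smallMultiplicity p w.1 / w.1 : ℚ) : ℝ) * Real.log (p : ℕ) := by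
    push_cast
    simp only [sum_mul]
    rw [sum_comm]
    refine sum_congr rfl fun w hw => ?_
    nth_rw 1 [← hfac w hw]
    rw [Nat.cast_prod, Real.log_prod fun p hp => by
      simp only [mem_insert, mem_singleton] at hp
      have : p ≠ 0 := by omega
      positivity]
    simp only [Nat.cast_pow, Real.log_pow, mul_sum, sum_div]
    exact sum_congr rfl fun p _ => by ring
  have h2 : ∑ w ∈ chebyshevWeights, (w.2 : ℚ) * smallMultiplicity 2 w.1 / w.1 =
      271471 / 360360 := by
    decide +kernel
  have h3 : ∑ w ∈ chebyshevWeights, (w.2 : ℚ) * smallMultiplicity 3 w.1 / w.1 =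
      -10187 / 9240 := by
    decide +kernel
  have h5 : ∑ w ∈ chebyshevWeights, (w.2 : ℚ) * smallMultiplicity 5 w.1 / w.1 =
      -2581 / 48048 := by
    decide +kernel
  have h7 : ∑ w ∈ chebyshevWeights, (w.2 : ℚ) * smallMultiplicity 7 w.1 / w.1 =
      18163 / 102960 := by
    decide +kernel
  have h11 : ∑ w ∈ chebyshevWeights, (w.2 : ℚ) * smallMultiplicity 11 w.1 / w.1 =
      1669 / 32760 := by
    decide +kernel
  have h13 : ∑ w ∈ chebyshevWeights, (w.2 : ℚ) * smallMultiplicity 13 w.1 / w.1 =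
      107 / 1232 := by
    decide +kernel
  have hmaj : ∑ w ∈ majorantJumps, (w.2 : ℝ) / w.1 < 53 / 1000 := by
    have : ∑ w ∈ majorantJumps, (w.2 : ℚ) / w.1 < 53 / 1000 := by decide +kernel
    have := (Rat.cast_lt (K := ℝ)).2 this
    push_cast at this
    exact this
  have l2 : 0 < Real.log 2 := Real.log_pos (by norm_num)
  have l3 : 19 * Real.log 2 < 12 * Real.log 3 := by
    have := Real.log_lt_log (by norm_num) (by norm_num : (2 : ℝ) ^ 19 < 3 ^ 12)
    simpa only [Real.log_pow, Nat.cast_ofNat] using this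
  have l5 : 16 * Real.log 2 < 7 * Real.log 5 := by
    have := Real.log_lt_log (by norm_num) (by norm_num : (2 : ℝ) ^ 16 < 5 ^ 7)
    simpa only [Real.log_pow, Nat.cast_ofNat] using this
  have l7 : 11 * Real.log 7 < 31 * Real.log 2 := by
    have := Real.log_lt_log (by norm_num) (by norm_num : (7 : ℝ) ^ 11 < 2 ^ 31)
    simpa only [Real.log_pow, Nat.cast_ofNat] using this
  have l11 : 2 * Real.log 11 < 7 * Real.log 2 := by
    have := Real.log_lt_log (by norm_num) (by norm_num : (11 : ℝ) ^ 2 < 2 ^ 7)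
    simpa only [Real.log_pow, Nat.cast_ofNat] using this
  have l13 : 7 * Real.log 13 < 26 * Real.log 2 := by
    have := Real.log_lt_log (by norm_num) (by norm_num : (13 : ℝ) ^ 7 < 2 ^ 26)
    simpa only [Real.log_pow, Nat.cast_ofNat] using this
  have h4 : Real.log 4 = 2 * Real.log 2 := by
    rw [show (4 : ℝ) = 2 ^ 2 by norm_num, Real.log_pow, Nat.cast_ofNat]
  rw [hlog, h4]
  simp only [mem_insert, mem_singleton, Nat.reduceEqDiff, or_self,
    not_false_eq_true, sum_insert, sum_singleton, h2, h3, h5, h7, h11, h13, Nat.cast_ofNat]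
  push_cast
  have := mul_lt_mul_of_pos_left hmaj l2
  linarith

theorem exceptionalQuotients_spec : ∀ y ∈ exceptionalQuotients, y ≤ 98 ∧
    0 ≤ (y : ℚ) * (∑ j ∈ Icc 1 (y / 3), (j.totient : ℚ) / j) -
      6 * ∑ j ∈ Icc 1 (y / 3), (j.totient : ℚ) ∧
    3 * (∑ j ∈ Icc 1 (y / 3), (j.totient : ℚ)) -
        6 * (∑ j ∈ Icc 1 (y / 3), (j.totient : ℚ) / j) <
      10000 * ((y : ℚ) * (∑ j ∈ Icc 1 (y / 3), (j.totient : ℚ) / j) -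
        6 * ∑ j ∈ Icc 1 (y / 3), (j.totient : ℚ)) := by
  decide +kernel

theorem finite_integer_recipFareyProd :
    {n : ℕ | 0 < n ∧ ∃ z : ℤ, recipFareyProd n = (z : ℚ)}.Finite := by
  have hev := eventually_exists_prime_div_mem (s := chebyshevWeights) (g := majorantJumps)
    (B := exceptionalQuotients) (by decide +kernel) (by decide +kernel) (by decide +kernel)
    (fun y hy => stepSum_chebyshevWeights_le hy) log_four_mul_lt_chebyshevWeights
  obtain ⟨N₀, hN₀⟩ := Filter.eventually_atTop.1 hev
  refine (Set.finite_lt_nat (N₀ + 33 * 10000)).subset ?_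
  rintro n ⟨-, z, hz⟩
  by_contra hn
  simp only [Set.mem_ofPred_eq, not_lt] at hn
  obtain ⟨p, -, hp, hy⟩ := hN₀ (3 * n) (by omega)
  obtain ⟨hle, hnonneg, hlt⟩ := exceptionalQuotients_spec _ hy
  have hpn : n < 33 * p := by
    have := Nat.lt_mul_of_div_lt (Nat.lt_succ_of_le hle) hp.pos
    omega
  have hp_ge : 10000 ≤ p := by omega
  have hmain := prime_mul_le_of_recipFareyProd_eq_intCast hz hp (by nlinarith) rfl
  have := mul_le_mul_of_nonneg_right (show (10000 : ℚ) ≤ p by exact_mod_cast hp_ge) hnonneg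
  linarith
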